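/- arXiv:1004.0500 — 2 statements merged into one kernel-verified Lean document; each statement's English description precedes it below -/
import Mathlib

section
/- Let K be a field and let A₁, …, Aₘ ∈ GL(n,K) and scalars λ₁, …, λₘ ∈ K with λ₁⋯λₘ = 1. If the identity matrix I is a product B₁⋯Bₘ where each Bᵢ is conjugate to Aᵢ, then for each j, rank(Aⱼ − λⱼI) ≤ Σ_{i≠j} rank(Aᵢ − λᵢI). -/
/-- Rank is subadditive. -/
theorem Matrix.rank_add_le {K κ ν : Type*} [Field K] [Finite κ] [Fintype ν]
    (A B : Matrix κ ν K) : (A + B).rank ≤ A.rank + B.rank := by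
  rw [rank, rank, rank, mulVecLin_add]
  exact (Submodule.finrank_mono (LinearMap.range_add_le _ _)).trans
    (Submodule.finrank_add_le_finrank_add_finrank _ _)

open Matrix in
/-- Distances to scalar matrices, measured by rank, are subadditive under products:
`rank(X₁ ⋯ Xₖ − μ₁ ⋯ μₖ I) ≤ ∑ rank(Xᵢ − μᵢ I)`. -/
theorem rank_list_prod_sub_smul_one_le {K ι ν : Type*} [Field K] [Fintype ν] [DecidableEq ν]
    (X : ι → Matrix ν ν K) (μ : ι → K) (l : List ι) :
    ((l.map X).prod - (l.map μ).prod • (1 : Matrix ν ν K)).rank ≤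
      (l.map fun i => (X i - μ i • (1 : Matrix ν ν K)).rank).sum := by
  induction l with
  | nil => simp
  | cons a l ih =>
    have key : ((a :: l).map X).prod - ((a :: l).map μ).prod • (1 : Matrix ν ν K) =
        (X a - μ a • (1 : Matrix ν ν K)) * (l.map X).prod +
          (μ a • (1 : Matrix ν ν K)) * ((l.map X).prod - (l.map μ).prod • (1 : Matrix ν ν K)) := by
      simp [sub_mul, smul_sub, smul_smul]
    rw [key, List.map_cons, List.sum_cons]
    exact (rank_add_le _ _).trans
      (add_le_add (rank_mul_le_left _ _) ((rank_mul_le_right _ _).trans ih))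

open Matrix in
/-- If `X Y Z = 1` and `a b c = 1` then `rank(Y − b I) ≤ rank(X Z − a c I)`. -/
theorem rank_sub_smul_one_le_of_mul_eq_one {K ν : Type*} [Field K] [Fintype ν] [DecidableEq ν]
    {X Y Z : (Matrix ν ν K)ˣ} (h : X * Y * Z = 1) {a b c : K} (habc : a * b * c = 1) :
    ((Y : Matrix ν ν K) - b • (1 : Matrix ν ν K)).rank ≤
      ((X : Matrix ν ν K) * (Z : Matrix ν ν K) - (a * c) • (1 : Matrix ν ν K)).rank := by
  have hY : Y = X⁻¹ * Z⁻¹ := by rw [eq_inv_mul_iff_mul_eq, eq_inv_iff_mul_eq_one, h]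
  have key : (Y : Matrix ν ν K) - b • (1 : Matrix ν ν K) =
      ((-b) • (↑X⁻¹ : Matrix ν ν K)) *
        ((X : Matrix ν ν K) * (Z : Matrix ν ν K) - (a * c) • (1 : Matrix ν ν K)) *
          (↑Z⁻¹ : Matrix ν ν K) := by
    have hb : b * (a * c) = 1 := by rw [← habc]; ring
    have hZ : (↑X⁻¹ : Matrix ν ν K) * ((X : Matrix ν ν K) * (Z : Matrix ν ν K)) *
        (↑Z⁻¹ : Matrix ν ν K) = 1 := by
      rw [mul_assoc, mul_assoc, Units.mul_inv, mul_one, Units.inv_mul]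
    rw [mul_sub, sub_mul, smul_mul_assoc, smul_mul_assoc, hZ, mul_smul_comm, mul_one,
      smul_smul, hY, Units.val_mul, smul_mul_assoc, mul_comm (a * c), neg_mul, hb]
    module
  rw [key]
  exact (rank_mul_le_left _ _).trans (rank_mul_le_right _ _)

open Matrix in
theorem rank_sub_smul_one_eq_of_isConj {K ν : Type*} [Field K] [Fintype ν] [DecidableEq ν]
    {A B : (Matrix ν ν K)ˣ} (h : IsConj A B) (c : K) :
    ((A : Matrix ν ν K) - c • (1 : Matrix ν ν K)).rank =
      ((B : Matrix ν ν K) - c • (1 : Matrix ν ν K)).rank := by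
  have le {A B : (Matrix ν ν K)ˣ} (h : IsConj A B) :
      ((B : Matrix ν ν K) - c • (1 : Matrix ν ν K)).rank ≤
        ((A : Matrix ν ν K) - c • (1 : Matrix ν ν K)).rank := by
    obtain ⟨P, rfl⟩ := isConj_iff.1 h
    have key : (↑(P * A * P⁻¹) : Matrix ν ν K) - c • (1 : Matrix ν ν K) =
        P * ((A : Matrix ν ν K) - c • (1 : Matrix ν ν K)) * (↑P⁻¹ : Matrix ν ν K) := by
      simp [mul_sub, sub_mul]
    rw [key]
    exact (rank_mul_le_left _ _).trans (rank_mul_le_right _ _)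
  exact le_antisymm (le h.symm) (le h)

/-- **Rank condition.** If the identity is a product of conjugates of
`A₁, …, Aₘ` in `GL(n,K)` and `λ₁ ⋯ λₘ = 1`, then for each `j`,
`rank(Aⱼ − λⱼ I) ≤ ∑_{i ≠ j} rank(Aᵢ − λᵢ I)`. -/
theorem rank_condition {K : Type*} [Field K] {n m : ℕ}
    (A : Fin m → (Matrix (Fin n) (Fin n) K)ˣ) (lam : Fin m → K)
    (hlam : ∏ i, lam i = 1)
    (B : Fin m → (Matrix (Fin n) (Fin n) K)ˣ)
    (hconj : ∀ i, IsConj (A i) (B i))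
    (hprod : (List.ofFn B).prod = 1) :
    ∀ j : Fin m,
      ((A j : Matrix (Fin n) (Fin n) K) - lam j • (1 : Matrix (Fin n) (Fin n) K)).rank ≤
        ∑ i ∈ Finset.univ.erase j,
          ((A i : Matrix (Fin n) (Fin n) K) - lam i • (1 : Matrix (Fin n) (Fin n) K)).rank := by
  intro j
  simp only [fun i => rank_sub_smul_one_eq_of_isConj (hconj i) (lam i)]
  obtain ⟨s, t, hst⟩ := List.append_of_mem (List.mem_finRange j)
  rw [List.ofFn_eq_map, hst, List.map_append, List.map_cons, List.prod_append, List.prod_cons,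
    ← mul_assoc] at hprod
  rw [← List.prod_ofFn, List.ofFn_eq_map, hst, List.map_append, List.map_cons, List.prod_append,
    List.prod_cons, ← mul_assoc] at hlam
  refine (rank_sub_smul_one_le_of_mul_eq_one hprod hlam).trans ?_
  have hle := rank_list_prod_sub_smul_one_le (fun i => (B i : Matrix (Fin n) (Fin n) K)) lam
    (s ++ t)
  have hcoe (l : List (Fin m)) : (↑(l.map B).prod : Matrix (Fin n) (Fin n) K) =
      (l.map fun i => (B i : Matrix (Fin n) (Fin n) K)).prod := by
    simpa [Function.comp_def] using map_list_prod (Units.coeHom (Matrix (Fin n) (Fin n) K))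
      (l.map B)
  rw [hcoe, hcoe, ← List.prod_append, ← List.map_append, ← List.prod_append, ← List.map_append]
  refine hle.trans_eq ?_
  have hsum (r : Fin m → ℕ) : ((s ++ t).map r).sum = ∑ i ∈ Finset.univ.erase j, r i := by
    have h := Finset.add_sum_erase Finset.univ r (Finset.mem_univ j)
    rw [← List.sum_ofFn, List.ofFn_eq_map, hst] at h
    simp only [List.map_append, List.map_cons, List.sum_append, List.sum_cons] at h ⊢
    omega
  exact hsum _
end

section
/- In the group F = Q₈ ⋊ ℤ₃ (with ia = aj, ja = ak, ka = ai, a³ = 1), the product of any three nontrivial conjugacy classes each different from {−1} is a full coset of Q₈ in F. -/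
open Pointwise

/-- The binary tetrahedral group `Q₈ ⋊ ℤ₃`; the triple `⟨p, q, r⟩` stands for
`i ^ p * j ^ q * a ^ r`. -/
structure BinaryTetrahedral where
  /-- The exponent of `i`. -/
  expI : Fin 4
  /-- The exponent of `j`. -/
  expJ : Fin 2
  /-- The exponent of `a`, which identifies the coset of `Q₈`. -/
  deg : Fin 3
  deriving DecidableEq, Fintype

namespace BinaryTetrahedral

/-- Left multiplication by `i`. -/
def mulI : BinaryTetrahedral → BinaryTetrahedral
  | ⟨p, q, r⟩ => ⟨p + 1, q, r⟩

/-- Left multiplication by `j`. -/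
def mulJ : BinaryTetrahedral → BinaryTetrahedral
  | ⟨p, 0, r⟩ => ⟨-p, 1, r⟩
  | ⟨p, 1, r⟩ => ⟨2 - p, 0, r⟩

/-- Left multiplication by `a`. -/
def mulA : BinaryTetrahedral → BinaryTetrahedral
  | ⟨0, 0, r⟩ => ⟨0, 0, r + 1⟩
  | ⟨1, 0, r⟩ => ⟨1, 1, r + 1⟩
  | ⟨2, 0, r⟩ => ⟨2, 0, r + 1⟩
  | ⟨3, 0, r⟩ => ⟨3, 1, r + 1⟩
  | ⟨0, 1, r⟩ => ⟨1, 0, r + 1⟩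
  | ⟨1, 1, r⟩ => ⟨0, 1, r + 1⟩
  | ⟨2, 1, r⟩ => ⟨3, 0, r + 1⟩
  | ⟨3, 1, r⟩ => ⟨2, 1, r + 1⟩

instance : One BinaryTetrahedral := ⟨⟨0, 0, 0⟩⟩

instance : Mul BinaryTetrahedral :=
  ⟨fun x y => mulI^[x.expI] (mulJ^[x.expJ] (mulA^[x.deg] y))⟩

instance : Inv BinaryTetrahedral :=
  ⟨fun x => mulA^[2 * x.deg] (mulJ^[3 * x.expJ] (mulI^[3 * x.expI] 1))⟩

theorem mul_def (x y : BinaryTetrahedral) :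
    x * y = mulI^[x.expI] (mulJ^[x.expJ] (mulA^[x.deg] y)) := rfl

theorem mulI_mul : ∀ x y : BinaryTetrahedral, mulI x * y = mulI (x * y) := by decide +kernel

theorem mulJ_mul : ∀ x y : BinaryTetrahedral, mulJ x * y = mulJ (x * y) := by decide +kernel

theorem mulA_mul : ∀ x y : BinaryTetrahedral, mulA x * y = mulA (x * y) := by decide +kernel

instance : Group BinaryTetrahedral :=
  Group.ofLeftAxioms
    (fun x y z => by
      have iterate_mul {f : BinaryTetrahedral → BinaryTetrahedral}
          (hf : ∀ x y, f x * y = f (x * y)) (k : ℕ) (x y : BinaryTetrahedral) :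
          f^[k] x * y = f^[k] (x * y) := by
        induction k generalizing x with
        | zero => rfl
        | succ k ih => rw [Function.iterate_succ_apply, ih, hf, Function.iterate_succ_apply]
      rw [mul_def x y, iterate_mul mulI_mul, iterate_mul mulJ_mul, iterate_mul mulA_mul,
        ← mul_def])
    (fun _ => rfl)
    (by decide +kernel)

theorem deg_mul : ∀ x y : BinaryTetrahedral, deg (x * y) = deg x + deg y := by decide +kernel

theorem deg_inv : ∀ x : BinaryTetrahedral, deg x⁻¹ = -deg x := by decide +kernel

/-- The conjugacy class of an element, as a finset. -/
def conjClass (x : BinaryTetrahedral) : Finset BinaryTetrahedral :=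
  Finset.univ.image fun g => g * x * g⁻¹

theorem mem_conjClass {x w : BinaryTetrahedral} : w ∈ conjClass x ↔ IsConj x w := by
  simp [conjClass, isConj_iff]

theorem deg_eq_of_isConj {x w : BinaryTetrahedral} (h : IsConj x w) : deg w = deg x := by
  obtain ⟨g, rfl⟩ := isConj_iff.1 h
  rw [deg_mul, deg_mul, deg_inv]
  abel

/-- The central involution `-1`. -/
def negOne : BinaryTetrahedral := ⟨2, 0, 0⟩

theorem setOf_isConj_negOne : {w | IsConj negOne w} = {negOne} := by
  have key : ∀ g : BinaryTetrahedral, g * negOne * g⁻¹ = negOne := by decide +kernel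
  ext w
  simp [isConj_iff, key, eq_comm]

/-- Representatives of the conjugacy classes other than `{1}` and `{-1}`. -/
def classReps : Finset BinaryTetrahedral :=
  {⟨1, 0, 0⟩, ⟨0, 0, 1⟩, ⟨2, 0, 1⟩, ⟨0, 0, 2⟩, ⟨2, 0, 2⟩}

theorem exists_conjClass_eq {x : BinaryTetrahedral} (h1 : x ≠ 1) (h2 : x ≠ negOne) :
    ∃ r ∈ classReps, conjClass x = conjClass r := by
  have key : ∀ x : BinaryTetrahedral, x ≠ 1 → x ≠ negOne →
      ∃ r ∈ classReps, ∃ g, g * r * g⁻¹ = x := by decide +kernel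
  obtain ⟨r, hr, hrx⟩ := key x h1 h2
  have hconj : IsConj r x := isConj_iff.2 hrx
  refine ⟨r, hr, Finset.ext fun w => ?_⟩
  rw [mem_conjClass, mem_conjClass]
  exact ⟨hconj.trans, hconj.symm.trans⟩

theorem four_le_card_conjClass : ∀ r ∈ classReps, 4 ≤ (conjClass r).card := by decide +kernel

theorem five_le_card_conjClass_mul :
    ∀ r ∈ classReps, ∀ s ∈ classReps, 5 ≤ (conjClass r * conjClass s).card := by decide +kernel

theorem card_deg_eq : ∀ d, (Finset.univ.filter fun x => deg x = d).card = 8 := by decide +kernel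

theorem deg_eq_of_mem_conjClass (x : BinaryTetrahedral) : ∀ w ∈ conjClass x, deg w = deg x :=
  fun _ hw => deg_eq_of_isConj (mem_conjClass.1 hw)

theorem deg_eq_of_mem_mul {A B : Finset BinaryTetrahedral} {d e : Fin 3}
    (hA : ∀ x ∈ A, deg x = d) (hB : ∀ x ∈ B, deg x = e) :
    ∀ w ∈ A * B, deg w = d + e := by
  intro w hw
  obtain ⟨u, hu, v, hv, rfl⟩ := Finset.mem_mul.1 hw
  rw [deg_mul, hA u hu, hB v hv]

/-- Two subsets of cosets of `Q₈` with more than eight elements in total have a full coset as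
their product. -/
theorem mul_eq_of_card {A B : Finset BinaryTetrahedral} {d e : Fin 3}
    (hA : ∀ x ∈ A, deg x = d) (hB : ∀ x ∈ B, deg x = e) (hcard : 8 < A.card + B.card) :
    A * B = Finset.univ.filter fun w => deg w = d + e := by
  ext w
  rw [Finset.mem_filter_univ]
  refine ⟨deg_eq_of_mem_mul hA hB w, fun hw => ?_⟩
  by_contra hmem
  have hdisj : Disjoint A (B.image fun b => w * b⁻¹) := by
    rw [Finset.disjoint_left]
    intro x hx hxB
    obtain ⟨b, hb, rfl⟩ := Finset.mem_image.1 hxB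
    exact hmem (Finset.mem_mul.2 ⟨_, hx, b, hb, inv_mul_cancel_right w b⟩)
  have hsub : A ∪ B.image (fun b => w * b⁻¹) ⊆ Finset.univ.filter fun x => deg x = d := by
    refine Finset.union_subset (fun x hx => by simp [hA x hx]) ?_
    refine Finset.image_subset_iff.2 fun b hb => ?_
    simp [deg_mul, deg_inv, hw, hB b hb]
  have hle := Finset.card_le_card hsub
  have hinj : Function.Injective fun b : BinaryTetrahedral => w * b⁻¹ :=
    (mul_right_injective w).comp inv_injective
  rw [Finset.card_union_of_disjoint hdisj, Finset.card_image_of_injective _ hinj,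
    card_deg_eq] at hle
  omega

theorem mul_isConj_eq {x y z : BinaryTetrahedral} (hx : x ≠ 1 ∧ x ≠ negOne)
    (hy : y ≠ 1 ∧ y ≠ negOne) (hz : z ≠ 1 ∧ z ≠ negOne) :
    {w | IsConj x w} * {w | IsConj y w} * {w | IsConj z w} =
      {w | deg w = deg x + deg y + deg z} := by
  have coe_conjClass (x : BinaryTetrahedral) : {w | IsConj x w} = (conjClass x : Set _) :=
    Set.ext fun w => mem_conjClass.symm
  have hcard : 8 < (conjClass x * conjClass y).card + (conjClass z).card := by
    obtain ⟨r, hr, hxr⟩ := exists_conjClass_eq hx.1 hx.2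
    obtain ⟨s, hs, hys⟩ := exists_conjClass_eq hy.1 hy.2
    obtain ⟨t, ht, hzt⟩ := exists_conjClass_eq hz.1 hz.2
    rw [hxr, hys, hzt]
    exact Nat.add_le_add (five_le_card_conjClass_mul r hr s hs) (four_le_card_conjClass t ht)
  rw [coe_conjClass, coe_conjClass, coe_conjClass, ← Finset.coe_mul, ← Finset.coe_mul,
    mul_eq_of_card (deg_eq_of_mem_mul (deg_eq_of_mem_conjClass x) (deg_eq_of_mem_conjClass y))
      (deg_eq_of_mem_conjClass z) hcard, Finset.coe_filter_univ]

section Eval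

variable {Γ : Type*} [Group Γ] {i j a : Γ}

/-- The element of `Γ` with normal form `x`. -/
def eval (i j a : Γ) (x : BinaryTetrahedral) : Γ :=
  i ^ (x.expI : ℕ) * j ^ (x.expJ : ℕ) * a ^ (x.deg : ℕ)

theorem eval_mulI (hi : i ^ 4 = 1) (x : BinaryTetrahedral) :
    eval i j a (mulI x) = i * eval i j a x := by
  obtain ⟨p, q, r⟩ := x
  have hp : i ^ ((p + 1 : Fin 4) : ℕ) = i * i ^ (p : ℕ) := by
    rw [← pow_succ', Fin.val_add, ← pow_eq_pow_mod _ hi]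
    rfl
  simp only [eval, mulI, hp, mul_assoc]

theorem eval_mulJ (hi : i ^ 4 = 1) (hj : j * j = i * i) (hji : j * i = i ^ 3 * j)
    (x : BinaryTetrahedral) : eval i j a (mulJ x) = j * eval i j a x := by
  obtain ⟨p, q, r⟩ := x
  have hi' (g : Γ) : i * (i * (i * (i * g))) = g := by
    simpa [pow_succ, mul_assoc] using congr($hi * g)
  have hj' (g : Γ) : j * (j * g) = i * (i * g) := by simpa [mul_assoc] using congr($hj * g)
  have hji' (g : Γ) : j * (i * g) = i * (i * (i * (j * g))) := by
    simpa [pow_succ, mul_assoc] using congr($hji * g)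
  fin_cases p <;> fin_cases q <;>
    simp [eval, mulJ, pow_succ, mul_assoc, hi', hj', hji', show (-2 : Fin 4) = 2 from rfl,
      show (-3 : Fin 4) = 1 from rfl]

theorem eval_mulA (hi : i ^ 4 = 1) (hj : j * j = i * i) (hji : j * i = i ^ 3 * j)
    (ha : a ^ 3 = 1) (hai : a * i = i * j * a) (haj : a * j = i * a)
    (x : BinaryTetrahedral) : eval i j a (mulA x) = a * eval i j a x := by
  obtain ⟨p, q, r⟩ := x
  have hr : a ^ ((r + 1 : Fin 3) : ℕ) = a * a ^ (r : ℕ) := by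
    rw [← pow_succ', Fin.val_add, ← pow_eq_pow_mod _ ha]
    rfl
  have hi' (g : Γ) : i * (i * (i * (i * g))) = g := by
    simpa [pow_succ, mul_assoc] using congr($hi * g)
  have hj' (g : Γ) : j * (j * g) = i * (i * g) := by simpa [mul_assoc] using congr($hj * g)
  have hji' (g : Γ) : j * (i * g) = i * (i * (i * (j * g))) := by
    simpa [pow_succ, mul_assoc] using congr($hji * g)
  have hai' (g : Γ) : a * (i * g) = i * (j * (a * g)) := by
    simpa [mul_assoc] using congr($hai * g)
  have haj' (g : Γ) : a * (j * g) = i * (a * g) := by simpa [mul_assoc] using congr($haj * g)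
  fin_cases p <;> fin_cases q <;>
    simp [eval, mulA, hr, pow_succ, mul_assoc, hi', hj', hji', hai', haj']

/-- The homomorphism from the binary tetrahedral group given by three elements satisfying its
defining relations. -/
def evalHom (hi : i ^ 4 = 1) (hj : j * j = i * i) (hji : j * i = i ^ 3 * j)
    (ha : a ^ 3 = 1) (hai : a * i = i * j * a) (haj : a * j = i * a) :
    BinaryTetrahedral →* Γ :=
  MonoidHom.mk' (eval i j a) fun x y => by
    have eval_iterate {f : BinaryTetrahedral → BinaryTetrahedral} {g : Γ}
        (hf : ∀ x, eval i j a (f x) = g * eval i j a x) (k : ℕ) (x : BinaryTetrahedral) :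
        eval i j a (f^[k] x) = g ^ k * eval i j a x := by
      induction k with
      | zero => simp
      | succ k ih => rw [Function.iterate_succ_apply', hf, ih, pow_succ', mul_assoc]
    rw [mul_def, eval_iterate (eval_mulI hi), eval_iterate (eval_mulJ hi hj hji),
      eval_iterate (eval_mulA hi hj hji ha hai haj), eval.eq_def i j a x]
    simp only [mul_assoc]

end Eval

/-- The subgroup `Q₈`. -/
def quaternionSubgroup : Subgroup BinaryTetrahedral where
  carrier := {x | deg x = 0}
  one_mem' := rfl
  mul_mem' {x y} hx hy := by
    rw [Set.mem_ofPred_eq] at *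
    rw [deg_mul, hx, hy, add_zero]
  inv_mem' {x} hx := by
    rw [Set.mem_ofPred_eq] at *
    rw [deg_inv, hx, neg_zero]

theorem mem_quaternionSubgroup {x : BinaryTetrahedral} : x ∈ quaternionSubgroup ↔ deg x = 0 :=
  Iff.rfl

end BinaryTetrahedral

theorem Function.Surjective.setOf_isConj_map {G H : Type*} [Group G] [Group H] {f : G →* H}
    (hf : Function.Surjective f) (x : G) : {w | IsConj (f x) w} = f '' {w | IsConj x w} := by
  ext w
  constructor
  · intro hw
    obtain ⟨c, rfl⟩ := isConj_iff.1 hw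
    obtain ⟨g, rfl⟩ := hf c
    exact ⟨g * x * g⁻¹, isConj_iff.2 ⟨g, rfl⟩, by simp⟩
  · rintro ⟨v, hv, rfl⟩
    exact f.map_isConj hv

/-- In `F = Q₈ ⋊ ℤ₃`, the product of any three nontrivial conjugacy classes each different
from `{−1}` is a full (right) coset of `Q₈` in `F`. -/
theorem product_three_classes_coset_Q8 {Γ : Type*} [Group Γ]
    (i j a n : Γ)
    (hcard : Nat.card Γ = 24)
    (hgen : Subgroup.closure {i, j, a} = ⊤)
    (hi : i * i = n) (hj : j * j = n) (hk : (i * j) * (i * j) = n)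
    (hn : n * n = 1) (hn1 : n ≠ 1)
    (ha : a ^ 3 = 1) (ha1 : a ≠ 1)
    (hia : i * a = a * j) (hja : j * a = a * (i * j)) (hka : (i * j) * a = a * i)
    (x y z : Γ)
    (hx : {w : Γ | IsConj x w} ≠ {1} ∧ {w : Γ | IsConj x w} ≠ {n})
    (hy : {w : Γ | IsConj y w} ≠ {1} ∧ {w : Γ | IsConj y w} ≠ {n})
    (hz : {w : Γ | IsConj z w} ≠ {1} ∧ {w : Γ | IsConj z w} ≠ {n}) :
    ∃ g : Γ, {w : Γ | IsConj x w} * {w : Γ | IsConj y w} * {w : Γ | IsConj z w} =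
      ((Subgroup.closure {i, j} : Subgroup Γ) : Set Γ) * {g} := by
  have hi4 : i ^ 4 = 1 := by rw [← hn, ← hi]; simp [pow_succ, mul_assoc]
  have hji : j * i = i ^ 3 * j := by
    have h : i * (j * i) = j := by
      rw [← hj] at hk
      exact mul_right_cancel (b := j) (by simpa only [mul_assoc] using hk)
    calc j * i = i ^ 3 * (i * (j * i)) := by
          rw [← mul_assoc (i ^ 3), ← pow_succ, hi4, one_mul]
      _ = i ^ 3 * j := by rw [h]
  let φ := BinaryTetrahedral.evalHom hi4 (hj.trans hi.symm) hji ha hka.symm hia.symm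
  have hφ : ∀ x, φ x = BinaryTetrahedral.eval i j a x := fun _ => rfl
  have hφi : φ ⟨1, 0, 0⟩ = i := by simp [hφ, BinaryTetrahedral.eval]
  have hφj : φ ⟨0, 1, 0⟩ = j := by simp [hφ, BinaryTetrahedral.eval]
  have hφa : φ ⟨0, 0, 1⟩ = a := by simp [hφ, BinaryTetrahedral.eval]
  have hφn : φ BinaryTetrahedral.negOne = n := by
    simp [hφ, BinaryTetrahedral.eval, BinaryTetrahedral.negOne, pow_two, hi]
  have hsurj : Function.Surjective φ := by
    rw [← MonoidHom.range_eq_top, eq_top_iff, ← hgen, Subgroup.closure_le]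
    rintro _ (rfl | rfl | rfl)
    exacts [⟨_, hφi⟩, ⟨_, hφj⟩, ⟨_, hφa⟩]
  have hQ : Subgroup.closure {i, j} = BinaryTetrahedral.quaternionSubgroup.map φ := by
    apply le_antisymm
    · rw [Subgroup.closure_le]
      rintro _ (rfl | rfl)
      exacts [⟨_, rfl, hφi⟩, ⟨_, rfl, hφj⟩]
    · rintro _ ⟨⟨p, q, r⟩, hr : r = 0, rfl⟩
      subst hr
      rw [hφ, BinaryTetrahedral.eval]
      simpa using mul_mem (pow_mem (Subgroup.subset_closure (by simp)) _)
        (pow_mem (Subgroup.subset_closure (by simp)) _)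
  have hne (p : BinaryTetrahedral)
      (h : {w : Γ | IsConj (φ p) w} ≠ {1} ∧ {w : Γ | IsConj (φ p) w} ≠ {n}) :
      p ≠ 1 ∧ p ≠ BinaryTetrahedral.negOne := by
    rw [hsurj.setOf_isConj_map] at h
    constructor
    · rintro rfl
      exact h.1 (by simp)
    · rintro rfl
      exact h.2 (by rw [BinaryTetrahedral.setOf_isConj_negOne, Set.image_singleton, hφn])
  obtain ⟨p, rfl⟩ := hsurj x
  obtain ⟨q, rfl⟩ := hsurj y
  obtain ⟨r, rfl⟩ := hsurj z
  refine ⟨φ (p * q * r), ?_⟩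
  simp only [hsurj.setOf_isConj_map, ← Set.image_mul]
  rw [BinaryTetrahedral.mul_isConj_eq (hne p hx) (hne q hy) (hne r hz), hQ,
    Subgroup.coe_map, ← Set.image_singleton, ← Set.image_mul]
  congr 1
  ext w
  rw [Set.mul_singleton, Set.image_mul_right, Set.mem_preimage, SetLike.mem_coe,
    BinaryTetrahedral.mem_quaternionSubgroup, BinaryTetrahedral.deg_mul,
    BinaryTetrahedral.deg_inv, BinaryTetrahedral.deg_mul, BinaryTetrahedral.deg_mul,
    ← sub_eq_add_neg, sub_eq_zero]
  rfl
end
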